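/- Let 1 ≤ d ≤ 3, T > 0, ε > 0, s ≥ −1, γ ≥ s + 2 with γ > 1. Let (ρ, u) and (r, U) be smooth solutions on [0,T] × 𝕋^d of the Euler–Korteweg system ∂_t ρ + div(ρu) = 0, ∂_t(ρu) + div(ρu⊗u) + ∇p(ρ) = ε² ρ ∇( K(ρ)Δρ + ½K'(ρ)|∇ρ|² ), with ρ, r positive and bounded above and below by positive constants and with all relevant derivatives bounded. If ρ(0,·) = r(0,·) and u(0,·) = U(0,·), then ρ = r and u = U on all of [0,T] × 𝕋^d (uniqueness of strong solutions via the relative entropy). -/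

import Mathlib

open MeasureTheory

noncomputable section

abbrev Vec (d : ℕ) := Fin d → ℝ

/-- Spatial partial derivative in direction `i`. -/
noncomputable def pd {d : ℕ} (i : Fin d) (f : Vec d → ℝ) (x : Vec d) : ℝ :=
  fderiv ℝ f x (Pi.single i 1)

/-- Periodicity with period `1` in each space direction: this models fields on the torus
`𝕋^d = (ℝ/ℤ)^d`. -/
def SpacePeriodic {d : ℕ} {α : Type*} (f : ℝ → Vec d → α) : Prop :=
  ∀ (t : ℝ) (x : Vec d) (k : Fin d → ℤ), f t (fun i => x i + (k i : ℝ)) = f t x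

/-- The Euler–Korteweg system on the torus for a pair `(ρ, u)`, with `p(z) = z^γ`,
`K(z) = ((s+3)²/4) z^s` (so `K'(z) = ((s+3)²/4) s z^(s−1)`), satisfied pointwise on
`[0,T] × 𝕋^d`:
`∂ₜρ + div(ρu) = 0`,
`∂ₜ(ρu) + div(ρu⊗u) + ∇p(ρ) = ε²ρ∇(K(ρ)Δρ + ½K'(ρ)|∇ρ|²)`. -/
def SolvesEuK (d : ℕ) (T ε γ s : ℝ) (ρ : ℝ → Vec d → ℝ) (u : ℝ → Vec d → Vec d) : Prop :=
  (∀ t ∈ Set.Icc 0 T, ∀ x : Vec d,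
    deriv (fun τ => ρ τ x) t + (∑ i, pd i (fun y => ρ t y * u t y i) x) = 0) ∧
  (∀ t ∈ Set.Icc 0 T, ∀ x : Vec d, ∀ i : Fin d,
    deriv (fun τ => ρ τ x * u τ x i) t
        + (∑ j, pd j (fun y => ρ t y * u t y i * u t y j) x)
        + pd i (fun y => ρ t y ^ γ) x
      = ε ^ 2 * ρ t x * pd i (fun y =>
          ((s + 3) ^ 2 / 4) * ρ t y ^ s * (∑ j, pd j (fun z => pd j (fun w => ρ t w) z) y)
            + (1 / 2) * (((s + 3) ^ 2 / 4) * s * ρ t y ^ (s - 1))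
                * ∑ j, (pd j (fun w => ρ t w) y) ^ 2) x)


theorem relative_energy_derivation_mem
    {A ι : Type*} [CommRing A] [Algebra ℝ A] [Fintype ι]
    (Dt : Derivation ℝ A A) (Dx : ι → Derivation ℝ A A)
    (hxt : ∀ i a, Dt (Dx i a) = Dx i (Dt a))
    (hxx : ∀ i j a, Dx i (Dx j a) = Dx j (Dx i a))
    (I Q : Ideal A) (N : AddSubgroup A)
    (hIQ : ∀ a ∈ I, ∀ b ∈ I, a * b ∈ Q) (hQN : ∀ a ∈ Q, a ∈ N)
    (hDN : ∀ i a, Dx i a ∈ N)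
    (ρ r n κ κr m mr g gr : A) (u U v : ι → A)
    (hn' : n = ρ - r) (hv' : ∀ i, v i = u i - U i)
    (hn : n ∈ I) (hdn : ∀ i, Dx i n ∈ I) (hv : ∀ i, v i ∈ I)
    (hκt : Dt κ = 2 * m * Dt ρ) (hκx : ∀ i, Dx i κ = 2 * m * Dx i ρ)
    (hκ : κ - κr ∈ I) (hdκ : ∀ i, Dx i (κ - κr) ∈ I)
    (hm : m - mr ∈ I) (hdm : ∀ i, Dx i (m - mr) ∈ I)
    (hg : g - gr ∈ I)
    (hmass : Dt ρ + ∑ i, Dx i (ρ * u i) - (Dt r + ∑ i, Dx i (r * U i)) ∈ Q)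
    (hmom : ∀ i, (Dt (u i) + ∑ j, u j * Dx j (u i) + g * Dx i ρ
        - Dx i (κ * ∑ j, Dx j (Dx j ρ) + m * ∑ j, Dx j ρ ^ 2))
      - (Dt (U i) + ∑ j, U j * Dx j (U i) + gr * Dx i r
        - Dx i (κr * ∑ j, Dx j (Dx j r) + mr * ∑ j, Dx j r ^ 2)) ∈ Q) :
    Dt (ρ * ∑ i, v i ^ 2 + κ * ∑ i, Dx i n ^ 2 + n ^ 2) ∈ N := by
  have hII : ∀ a ∈ I, ∀ b ∈ I, ∀ c, c * (a * b) ∈ Q := fun a ha b hb c =>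
    Q.mul_mem_left c (hIQ a ha b hb)
  have hr : r = ρ - n := by rw [hn']; ring
  -- transport terms
  have htrans : ∀ j W f, f ∈ I → W * (2 * f * Dx j f) ∈ N := by
    intro j W f hf
    have h1 : W * (2 * f * Dx j f) = Dx j (W * f ^ 2) - Dx j W * (f * f) := by
      simp only [Derivation.leibniz, Derivation.leibniz_pow, smul_eq_mul, nsmul_eq_mul]
      push_cast; ring
    rw [h1]
    exact sub_mem (hDN _ _) (hQN _ (hII _ hf _ hf _))
  obtain ⟨M, hM⟩ : ∃ M, M = κ * ∑ j, Dx j (Dx j n) + m * ∑ j, (Dx j ρ ^ 2 - Dx j r ^ 2) := ⟨_, rfl⟩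
  obtain ⟨B, hB⟩ : ∃ B, B = (κ - κr) * ∑ j, Dx j (Dx j r) + (m - mr) * ∑ j, Dx j r ^ 2 := ⟨_, rfl⟩
  have hMB : M + B = (κ * ∑ j, Dx j (Dx j ρ) + m * ∑ j, Dx j ρ ^ 2) -
      (κr * ∑ j, Dx j (Dx j r) + mr * ∑ j, Dx j r ^ 2) := by
    rw [hM, hB, hn']; simp only [map_sub, Finset.sum_sub_distrib]; ring
  have hdB : ∀ i, Dx i B ∈ I := by
    intro i
    rw [hB]
    simp only [map_add, Derivation.leibniz, smul_eq_mul]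
    exact add_mem (add_mem (I.mul_mem_right _ hκ) (I.mul_mem_left _ (hdκ i)))
      (add_mem (I.mul_mem_right _ hm) (I.mul_mem_left _ (hdm i)))
  have hgI : ∀ i, g * Dx i ρ - gr * Dx i r ∈ I := by
    intro i
    have : g * Dx i ρ - gr * Dx i r = g * Dx i n + (g - gr) * Dx i r := by
      rw [hn', map_sub]; ring
    rw [this]
    exact add_mem (I.mul_mem_left _ (hdn i)) (I.mul_mem_right _ hg)
  -- momentum equation tested against the velocity difference
  have hmomN : ∀ i, 2 * ρ * v i * Dt (v i) + 2 * M * Dx i (ρ * v i) ∈ N := by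
    intro i
    have e1 : 2 * ρ * v i * Dt (v i) + 2 * M * Dx i (ρ * v i) =
        2 * ρ * v i * ((Dt (u i) + ∑ j, u j * Dx j (u i) + g * Dx i ρ
        - Dx i (κ * ∑ j, Dx j (Dx j ρ) + m * ∑ j, Dx j ρ ^ 2))
      - (Dt (U i) + ∑ j, U j * Dx j (U i) + gr * Dx i r
        - Dx i (κr * ∑ j, Dx j (Dx j r) + mr * ∑ j, Dx j r ^ 2)))
        - ∑ j, (ρ * u j) * (2 * v i * Dx j (v i))
        - ∑ j, 2 * ρ * Dx j (U i) * (v i * v j)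
        - 2 * ρ * (v i * (g * Dx i ρ - gr * Dx i r))
        + 2 * ρ * (v i * Dx i B)
        + (Dx i (ρ * v i * M) + Dx i (ρ * v i * M)) := by
      have h1 : ∑ j, u j * Dx j (u i) - ∑ j, U j * Dx j (U i) =
          ∑ j, u j * Dx j (v i) + ∑ j, v j * Dx j (U i) := by
        rw [← Finset.sum_sub_distrib, ← Finset.sum_add_distrib]
        refine Finset.sum_congr rfl fun j _ => ?_
        rw [hv', hv', map_sub]; ring
      have h2 : Dx i M + Dx i B = Dx i (κ * ∑ j, Dx j (Dx j ρ) + m * ∑ j, Dx j ρ ^ 2) -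
          Dx i (κr * ∑ j, Dx j (Dx j r) + mr * ∑ j, Dx j r ^ 2) := by
        rw [← map_add, hMB, map_sub]
      have h3 : Dt (v i) = Dt (u i) - Dt (U i) := by rw [hv', map_sub]
      have h4 : ∑ j, (ρ * u j) * (2 * v i * Dx j (v i)) =
          2 * ρ * v i * ∑ j, u j * Dx j (v i) := by
        rw [Finset.mul_sum]; exact Finset.sum_congr rfl fun j _ => by ring
      have h5 : ∑ j, 2 * ρ * Dx j (U i) * (v i * v j) =
          2 * ρ * v i * ∑ j, v j * Dx j (U i) := by
        rw [Finset.mul_sum]; exact Finset.sum_congr rfl fun j _ => by ring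
      have h6 : Dx i (ρ * v i * M) = ρ * v i * Dx i M + M * Dx i (ρ * v i) := by
        rw [Derivation.leibniz]; simp only [smul_eq_mul]
      rw [h3, h4, h5, h6]
      linear_combination (-2 * ρ * v i) * h1 - (2 * ρ * v i) * h2
    rw [e1]
    refine add_mem (add_mem (sub_mem (sub_mem (sub_mem ?_ ?_) ?_) ?_) ?_) ?_
    · exact hQN _ (Q.mul_mem_left _ (hmom i))
    · exact sum_mem fun j _ => htrans _ _ _ (hv i)
    · exact sum_mem fun j _ => hQN _ (hII _ (hv i) _ (hv j) _)
    · exact hQN _ (hII _ (hv i) _ (hgI i) _)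
    · exact hQN _ (hII _ (hv i) _ (hdB i) _)
    · exact add_mem (hDN _ _) (hDN _ _)
  obtain ⟨q, hq⟩ : ∃ q, q = Dt n + ∑ i, Dx i (ρ * v i) + ∑ i, Dx i (n * U i) := ⟨_, rfl⟩
  have hqQ : q ∈ Q := by
    convert hmass using 1
    rw [hq, hn', map_sub, add_assoc, ← Finset.sum_add_distrib]
    have : ∀ i, Dx i (ρ * v i) + Dx i ((ρ - r) * U i) = Dx i (ρ * u i) - Dx i (r * U i) := by
      intro i; rw [← map_add, ← map_sub, hv']; congr 1; ring
    simp only [this, Finset.sum_sub_distrib]; ring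
  obtain ⟨Y, hY⟩ : ∃ Y, Y = ∑ i, Dx i (n * U i) := ⟨_, rfl⟩
  obtain ⟨P, hP⟩ : ∃ P, P = ∑ i, Dx i (ρ * v i) := ⟨_, rfl⟩
  obtain ⟨S, hS⟩ : ∃ S, S = ∑ i, Dx i (κ * Dx i n) := ⟨_, rfl⟩
  obtain ⟨G, hG⟩ : ∃ G, G = ∑ i, Dx i n ^ 2 := ⟨_, rfl⟩
  have hGQ : G ∈ Q := by
    rw [hG]; refine sum_mem fun i _ => ?_
    rw [pow_two]; exact hIQ _ (hdn i) _ (hdn i)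
  have hSM : S = M + m * G := by
    rw [hS, hM, hG, add_assoc, ← mul_add, ← Finset.sum_add_distrib, Finset.mul_sum,
      Finset.mul_sum, ← Finset.sum_add_distrib]
    refine Finset.sum_congr rfl fun i _ => ?_
    rw [Derivation.leibniz, hκx, hr, map_sub]; simp only [smul_eq_mul]; ring
  -- capillary term transported by the second velocity
  have hSY : S * Y ∈ N := by
    rw [hS, hY, Finset.sum_mul_sum]
    refine sum_mem fun i _ => sum_mem fun j _ => ?_
    have e1 : Dx i (κ * Dx i n) * Dx j (n * U j) =
        Dx i (κ * Dx i n * Dx j (n * U j)) - (κ * Dx j (U j)) * (Dx i n * Dx i n)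
          - (κ * Dx i (U j)) * (Dx i n * Dx j n) - (κ * Dx i (Dx j (U j))) * (Dx i n * n)
          - (algebraMap ℝ A (1 / 2) * κ * U j) * (2 * Dx i n * Dx j (Dx i n)) := by
      have h2 : algebraMap ℝ A (1 / 2) * 2 = 1 := by
        rw [← map_ofNat (algebraMap ℝ A) 2, ← map_mul]; norm_num
      simp only [Derivation.leibniz, map_add, smul_eq_mul,
        hxx i j n]
      linear_combination (κ * U j * Dx i n * Dx j (Dx i n)) * h2
    rw [e1]
    exact sub_mem (sub_mem (sub_mem (sub_mem (hDN _ _) (hQN _ (hII _ (hdn i) _ (hdn i) _)))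
      (hQN _ (hII _ (hdn i) _ (hdn j) _))) (hQN _ (hII _ (hdn i) _ hn _)))
      (htrans _ _ _ (hdn i))
  have hnn : n * Dt n ∈ N := by
    have e1 : n * Dt n = n * q - ∑ i, Dx i (n * (ρ * v i)) + ∑ i, ρ * (Dx i n * v i)
        - ∑ i, (U i * (n * Dx i n) + Dx i (U i) * (n * n)) := by
      rw [hq, mul_add, mul_add, Finset.mul_sum, Finset.mul_sum]
      have h1 : ∑ i, Dx i (n * (ρ * v i)) = ∑ i, n * Dx i (ρ * v i) + ∑ i, ρ * (Dx i n * v i) := by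
        rw [← Finset.sum_add_distrib]
        refine Finset.sum_congr rfl fun i _ => ?_
        rw [Derivation.leibniz]; simp only [smul_eq_mul]; ring
      have h2 : ∑ i, n * Dx i (n * U i) = ∑ i, (U i * (n * Dx i n) + Dx i (U i) * (n * n)) := by
        refine Finset.sum_congr rfl fun i _ => ?_
        rw [Derivation.leibniz]; simp only [smul_eq_mul]; ring
      rw [h1, h2]; ring
    rw [e1]
    refine sub_mem (add_mem (sub_mem (hQN _ (Q.mul_mem_left _ hqQ)) ?_) ?_) ?_
    · exact sum_mem fun i _ => hDN _ _
    · exact sum_mem fun i _ => hQN _ (hII _ (hdn i) _ (hv i) _)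
    · exact sum_mem fun i _ => hQN _ (add_mem (hII _ hn _ (hdn i) _) (hII _ hn _ hn _))
  have key : Dt (ρ * ∑ i, v i ^ 2 + κ * ∑ i, Dx i n ^ 2 + n ^ 2) =
      Dt ρ * ∑ i, v i * v i + ∑ i, (2 * ρ * v i * Dt (v i) + 2 * M * Dx i (ρ * v i))
      + (2 * m * (P + Dt ρ)) * G + ∑ i, (Dx i (κ * Dx i n * Dt n) + Dx i (κ * Dx i n * Dt n))
      - 2 * S * q + (S * Y + S * Y) + (n * Dt n + n * Dt n) := by
    have h1 : Dt (∑ i, v i ^ 2) = ∑ i, 2 * v i * Dt (v i) := by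
      rw [map_sum]; refine Finset.sum_congr rfl fun i _ => ?_
      rw [Derivation.leibniz_pow]; simp [mul_assoc]
    have h2 : Dt (∑ i, Dx i n ^ 2) = ∑ i, 2 * Dx i n * Dx i (Dt n) := by
      rw [map_sum]; refine Finset.sum_congr rfl fun i _ => ?_
      rw [Derivation.leibniz_pow, hxt]; simp [mul_assoc]
    have h3 : ∑ i, (2 * ρ * v i * Dt (v i) + 2 * M * Dx i (ρ * v i)) =
        ρ * ∑ i, 2 * v i * Dt (v i) + 2 * M * P := by
      rw [Finset.sum_add_distrib, hP, Finset.mul_sum, Finset.mul_sum]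
      congr 1; exact Finset.sum_congr rfl fun i _ => by ring
    have h4 : ∑ i, (Dx i (κ * Dx i n * Dt n) + Dx i (κ * Dx i n * Dt n)) =
        κ * (∑ i, 2 * Dx i n * Dx i (Dt n)) + 2 * S * Dt n := by
      rw [hS, Finset.mul_sum, Finset.mul_sum, Finset.sum_mul, ← Finset.sum_add_distrib]
      refine Finset.sum_congr rfl fun i _ => ?_
      rw [Derivation.leibniz (Dx i) (κ * Dx i n)]; simp only [smul_eq_mul]; ring
    have h5 : ∑ i, v i ^ 2 = ∑ i, v i * v i := Finset.sum_congr rfl fun i _ => by ring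
    rw [h3, h4, map_add, map_add, Derivation.leibniz, Derivation.leibniz, h1, h2, hκt,
      Derivation.leibniz_pow, ← hG, h5, hq, ← hP, ← hY, hSM]
    simp only [smul_eq_mul, nsmul_eq_mul]
    push_cast
    ring
  rw [key]
  refine add_mem (add_mem (sub_mem (add_mem (add_mem (add_mem ?_ ?_) ?_) ?_) ?_) ?_) ?_
  · exact hQN _ (Q.mul_mem_left _ (sum_mem fun i _ => hIQ _ (hv i) _ (hv i)))
  · exact sum_mem fun i _ => hmomN i
  · exact hQN _ (Q.mul_mem_left _ hGQ)
  · exact sum_mem fun i _ => add_mem (hDN _ _) (hDN _ _)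
  · exact hQN _ (Q.mul_mem_left _ hqQ)
  · exact add_mem hSY hSY
  · exact add_mem hnn hnn

open Asymptotics Filter Topology

/-- Smooth functions on `ℝ × ℝ^d` that are `ℤ^d`-periodic in the space variable. -/
def periodicSmooth (d : ℕ) : Subalgebra ℝ (ℝ × Vec d → ℝ) where
  carrier := {F | ContDiff ℝ (⊤ : ℕ∞) F ∧
    ∀ (t : ℝ) (x : Vec d) (k : Fin d → ℤ), F (t, fun i => x i + (k i : ℝ)) = F (t, x)}
  mul_mem' := fun ⟨ha, ha'⟩ ⟨hb, hb'⟩ => ⟨ha.mul hb, fun t x k => by simp [ha', hb']⟩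
  add_mem' := fun ⟨ha, ha'⟩ ⟨hb, hb'⟩ => ⟨ha.add hb, fun t x k => by simp [ha', hb']⟩
  algebraMap_mem' := fun r => ⟨contDiff_const, fun _ _ _ => rfl⟩

namespace periodicSmooth

variable {d : ℕ}

theorem contDiff (F : periodicSmooth d) : ContDiff ℝ (⊤ : ℕ∞) F.1 := F.2.1

theorem continuous (F : periodicSmooth d) : Continuous F.1 := (contDiff F).continuous

theorem differentiable (F : periodicSmooth d) : Differentiable ℝ F.1 :=
  (contDiff F).differentiable (by simp)

theorem continuous_slice (F : periodicSmooth d) (t : ℝ) : Continuous fun x => F.1 (t, x) :=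
  (continuous F).comp (by fun_prop)

theorem fderiv_periodic (F : periodicSmooth d) (t : ℝ) (x : Vec d) (k : Fin d → ℤ) :
    fderiv ℝ F.1 (t, fun i => x i + (k i : ℝ)) = fderiv ℝ F.1 (t, x) := by
  have h : (fun p : ℝ × Vec d => F.1 (p + (0, fun i => (k i : ℝ)))) = F.1 := by
    funext p
    have := F.2.2 p.1 p.2 k
    convert this using 2
    ext <;> simp
  have h2 := fderiv_comp_add_right (𝕜 := ℝ) (f := F.1) (x := (t, x)) (0, fun i => (k i : ℝ))
  rw [h] at h2
  rw [h2]
  congr 1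
  ext <;> simp

/-- Directional derivative as a derivation of the algebra of smooth periodic functions. -/
def dirDeriv (v : ℝ × Vec d) : Derivation ℝ (periodicSmooth d) (periodicSmooth d) :=
  Derivation.mk'
    { toFun := fun F => ⟨fun p => fderiv ℝ F.1 p v,
        ((contDiff F).fderiv_right (m := (⊤ : ℕ∞)) (by simp)).clm_apply contDiff_const,
        fun t x k => by simp only [fderiv_periodic F]⟩
      map_add' := fun F G => Subtype.ext <| funext fun p => by
        change fderiv ℝ (F.1 + G.1) p v = fderiv ℝ F.1 p v + fderiv ℝ G.1 p v
        rw [fderiv_add (differentiable F p) (differentiable G p)]; rfl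
      map_smul' := fun c F => Subtype.ext <| funext fun p => by
        change fderiv ℝ (c • F.1) p v = c • fderiv ℝ F.1 p v
        rw [fderiv_const_smul (differentiable F p)]; rfl }
    (fun F G => Subtype.ext <| funext fun p => by
      change fderiv ℝ (F.1 * G.1) p v = F.1 p * fderiv ℝ G.1 p v + G.1 p * fderiv ℝ F.1 p v
      rw [fderiv_mul (differentiable F p) (differentiable G p)]; rfl)

theorem dirDeriv_apply (v : ℝ × Vec d) (F : periodicSmooth d) (p : ℝ × Vec d) :
    (dirDeriv v F).1 p = fderiv ℝ F.1 p v := rfl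

theorem dirDeriv_comm (v w : ℝ × Vec d) (F : periodicSmooth d) :
    dirDeriv v (dirDeriv w F) = dirDeriv w (dirDeriv v F) := by
  refine Subtype.ext <| funext fun p => ?_
  have hsymm : IsSymmSndFDerivAt ℝ F.1 p :=
    ((contDiff F).contDiffAt).isSymmSndFDerivAt (by
      rw [minSmoothness_of_isRCLikeNormedField]
      exact WithTop.coe_le_coe.2 (le_top : (2 : ℕ∞) ≤ ⊤))
  have hd : DifferentiableAt ℝ (fderiv ℝ F.1) p :=
    ((contDiff F).fderiv_right (m := (⊤ : ℕ∞)) (by simp)).differentiable (by simp) p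
  have h : ∀ v w : ℝ × Vec d, (dirDeriv v (dirDeriv w F)).1 p =
      fderiv ℝ (fderiv ℝ F.1) p v w := by
    intro v w
    change fderiv ℝ (fun q => fderiv ℝ F.1 q w) p v = _
    rw [fderiv_clm_apply hd (differentiableAt_const w)]
    simp
  rw [h, h]
  exact hsymm.eq v w

/-- Composition of a smooth function of one variable with a smooth periodic function. -/
def comp (f : ℝ → ℝ) (hf : ContDiff ℝ (⊤ : ℕ∞) f) (F : periodicSmooth d) : periodicSmooth d :=
  ⟨fun p => f (F.1 p), hf.comp (contDiff F), fun t x k => by simp only [F.2.2]⟩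

theorem _root_.ContDiff.deriv_infty {f : ℝ → ℝ} (hf : ContDiff ℝ (⊤ : ℕ∞) f) :
    ContDiff ℝ (⊤ : ℕ∞) (deriv f) := by
  have : ContDiff ℝ ((⊤ : ℕ∞) + 1) f := by simpa using hf
  exact (contDiff_succ_iff_deriv.1 this).2.2

theorem dirDeriv_comp (f : ℝ → ℝ) (hf : ContDiff ℝ (⊤ : ℕ∞) f) (F : periodicSmooth d)
    (v : ℝ × Vec d) :
    dirDeriv v (comp f hf F) = comp (deriv f) hf.deriv_infty F * dirDeriv v F := by
  refine Subtype.ext <| funext fun p => ?_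
  change fderiv ℝ (fun q => f (F.1 q)) p v = deriv f (F.1 p) * fderiv ℝ F.1 p v
  have h1 : HasDerivAt f (deriv f (F.1 p)) (F.1 p) :=
    (hf.differentiable (by simp) _).hasDerivAt
  have h2 : HasFDerivAt (fun q => f (F.1 q)) _ p :=
    h1.comp_hasFDerivAt p (differentiable F p).hasFDerivAt
  rw [h2.fderiv]
  simp

theorem isBigO_one (F : periodicSmooth d) (T : ℝ) :
    F.1 =O[𝓟 (Set.Icc 0 T ×ˢ Set.univ)] (fun _ => (1 : ℝ)) := by
  obtain ⟨C, hC⟩ := ((isCompact_Icc (a := (0 : ℝ)) (b := T)).prod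
    (isCompact_Icc (a := (0 : Vec d)) (b := 1))).exists_bound_of_continuousOn
      (continuous F).continuousOn
  refine IsBigO.of_bound C ?_
  rw [eventually_principal]
  rintro ⟨t, x⟩ ⟨ht, -⟩
  have h := F.2.2 t (fun i => Int.fract (x i)) (fun i => ⌊x i⌋)
  simp only [Int.fract_add_floor] at h
  have h2 := hC (t, fun i => Int.fract (x i)) ⟨ht, fun i => Int.fract_nonneg _,
    fun i => (Int.fract_lt_one _).le⟩
  rw [h]
  simpa using h2

/-- The ideal of functions which are `O(w)` uniformly on `[0,T] × ℝ^d`. -/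
def bigOIdeal (T : ℝ) (w : ℝ × Vec d → ℝ) : Ideal (periodicSmooth d) where
  carrier := {F | F.1 =O[𝓟 (Set.Icc 0 T ×ˢ Set.univ)] w}
  add_mem' := fun ha hb => IsBigO.add ha hb
  zero_mem' := isBigO_zero _ _
  smul_mem' := fun c F hF => by
    exact ((isBigO_one c T).mul hF).congr_right fun _ => one_mul _

/-- Integral over the unit cell of the time slice at time `t`. -/
def cellIntegral (F : periodicSmooth d) (t : ℝ) : ℝ :=
  ∫ x in Set.Icc (0 : Vec d) 1, F.1 (t, x)

theorem integrableOn_slice (F : periodicSmooth d) (t : ℝ) :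
    IntegrableOn (fun x => F.1 (t, x)) (Set.Icc (0 : Vec d) 1) :=
  (continuous_slice F t).continuousOn.integrableOn_compact isCompact_Icc

/-- Functions whose cell integrals are controlled by those of `e` on `[0,T]`. -/
def integralControlled (T : ℝ) (e : periodicSmooth d) : AddSubgroup (periodicSmooth d) where
  carrier := {F | (cellIntegral F) =O[𝓟 (Set.Icc 0 T)] (cellIntegral e)}
  add_mem' := fun {F G} hF hG => by
    refine (IsBigO.add hF hG).congr_left fun t => ?_
    exact (integral_add (integrableOn_slice F t) (integrableOn_slice G t)).symm
  zero_mem' := by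
    refine (isBigO_zero _ _).congr_left fun t => ?_
    exact (integral_zero _ _).symm
  neg_mem' := fun {F} hF => by
    refine (IsBigO.neg_left hF).congr_left fun t => ?_
    exact (integral_neg _).symm

theorem bigOIdeal_le_integralControlled {T : ℝ} {e : periodicSmooth d}
    (he : ∀ t ∈ Set.Icc 0 T, ∀ x, 0 ≤ e.1 (t, x)) {F : periodicSmooth d}
    (hF : F ∈ bigOIdeal T e.1) : F ∈ integralControlled T e := by
  obtain ⟨C, hC⟩ := IsBigO.bound hF
  rw [eventually_principal] at hC
  refine IsBigO.of_bound C ?_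
  rw [eventually_principal]
  intro t ht
  have h1 : ‖cellIntegral F t‖ ≤ ∫ x in Set.Icc (0 : Vec d) 1, C * e.1 (t, x) := by
    refine norm_integral_le_of_norm_le ((integrableOn_slice e t).const_mul C) ?_
    refine Eventually.of_forall fun x => ?_
    have := hC (t, x) ⟨ht, trivial⟩
    rwa [Real.norm_of_nonneg (he t ht x)] at this
  have h2 : 0 ≤ cellIntegral e t := integral_nonneg fun x => he t ht x
  rw [integral_const_mul] at h1
  rwa [Real.norm_of_nonneg h2]

/-- Space derivatives of periodic functions have vanishing cell integral. -/
theorem cellIntegral_dirDeriv_space (i : Fin d) (F : periodicSmooth d) (t : ℝ) :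
    cellIntegral (dirDeriv (0, Pi.single i 1) F) t = 0 := by
  obtain ⟨n, rfl⟩ : ∃ n, d = n + 1 := ⟨d - 1, by have := i.isLt; omega⟩
  have hder : ∀ x : Vec (n + 1), HasFDerivAt (fun y => F.1 (t, y))
      ((fderiv ℝ F.1 (t, x)).comp (ContinuousLinearMap.inr ℝ ℝ (Vec (n + 1)))) x := fun x =>
    (differentiable F (t, x)).hasFDerivAt.comp x (hasFDerivAt_prodMk_right t x)
  have key := integral_divergence_of_hasFDerivAt_off_countable' (E := ℝ) (0 : Vec (n + 1)) 1
    (fun _ => zero_le_one)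
    (fun j x => if j = i then F.1 (t, x) else 0)
    (fun j x => if j = i then
      (fderiv ℝ F.1 (t, x)).comp (ContinuousLinearMap.inr ℝ ℝ (Vec (n + 1))) else 0)
    ∅ Set.countable_empty
    (fun j => by
      split_ifs
      · exact (continuous_slice F t).continuousOn
      · exact continuousOn_const)
    (fun x _ j => by
      split_ifs
      · exact hder x
      · exact hasFDerivAt_const _ _)
    (by
      refine (integrableOn_slice (dirDeriv (0, Pi.single i 1) F) t).congr_fun ?_ measurableSet_Icc
      intro x _
      simp [apply_ite, dirDeriv_apply, ite_apply])
  have hL : cellIntegral (dirDeriv (0, Pi.single i 1) F) t = ∫ x in Set.Icc (0 : Vec (n + 1)) 1,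
      ∑ j, (if j = i then
      (fderiv ℝ F.1 (t, x)).comp (ContinuousLinearMap.inr ℝ ℝ (Vec (n + 1))) else 0)
        (Pi.single j 1) := by
    refine setIntegral_congr_fun measurableSet_Icc fun x _ => ?_
    simp [apply_ite, dirDeriv_apply, ite_apply]
  rw [hL, key]
  refine Finset.sum_eq_zero fun j _ => ?_
  by_cases hj : j = i
  · subst hj
    simp only [if_true]
    rw [sub_eq_zero]
    refine setIntegral_congr_fun measurableSet_Icc fun x _ => ?_
    have h := F.2.2 t (j.insertNth 0 x) (Pi.single j 1)
    change F.1 (t, j.insertNth 1 x) = F.1 (t, j.insertNth 0 x)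
    rw [← h]
    have hx : (j.insertNth 1 x : Vec (n + 1)) =
        fun i => (j.insertNth 0 x : Vec (n + 1)) i + ((Pi.single j 1 : Fin (n + 1) → ℤ) i : ℝ) := by
      funext k
      refine Fin.succAboveCases j ?_ (fun k => ?_) k <;> simp
    rw [hx]
  · simp [hj]

theorem hasDerivAt_time (F : periodicSmooth d) (t : ℝ) (x : Vec d) :
    HasDerivAt (fun τ => F.1 (τ, x)) ((dirDeriv (1, 0) F).1 (t, x)) t := by
  have h := (differentiable F (t, x)).hasFDerivAt.comp_hasDerivAt t
    ((hasDerivAt_id t).prodMk (hasDerivAt_const t x))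
  exact h

theorem hasDerivAt_cellIntegral (F : periodicSmooth d) (t : ℝ) :
    HasDerivAt (cellIntegral F) (cellIntegral (dirDeriv (1, 0) F) t) t := by
  obtain ⟨C, hC⟩ := ((isCompact_closedBall t 1).prod
    (isCompact_Icc (a := (0 : Vec d)) (b := 1))).exists_bound_of_continuousOn
      (continuous (dirDeriv (1, 0) F)).continuousOn
  refine (hasDerivAt_integral_of_dominated_loc_of_deriv_le (bound := fun _ => C)
    (F := fun τ x => F.1 (τ, x)) (F' := fun τ x => (dirDeriv (1, 0) F).1 (τ, x))
    (Metric.closedBall_mem_nhds t one_pos) ?_ (integrableOn_slice F t) ?_ ?_ ?_ ?_).2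
  · exact Eventually.of_forall fun τ => (continuous_slice F τ).aestronglyMeasurable
  · exact (continuous_slice (dirDeriv (1, 0) F) t).aestronglyMeasurable
  · refine (ae_restrict_iff' measurableSet_Icc).2 (Eventually.of_forall fun x hx τ hτ => ?_)
    exact hC (τ, x) ⟨hτ, hx⟩
  · exact continuousOn_const.integrableOn_compact isCompact_Icc
  · exact Eventually.of_forall fun x τ _ => hasDerivAt_time F τ x

/-- Grönwall: a nonnegative density with vanishing initial data whose time derivative is
controlled in the mean by itself vanishes. -/
theorem eq_zero_of_dirDeriv_mem {T : ℝ} {e : periodicSmooth d}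
    (he : ∀ t ∈ Set.Icc 0 T, ∀ x, 0 ≤ e.1 (t, x)) (h0 : ∀ x, e.1 (0, x) = 0)
    (hder : dirDeriv (1, 0) e ∈ integralControlled T e) :
    ∀ t ∈ Set.Icc 0 T, ∀ x, e.1 (t, x) = 0 := by
  obtain ⟨C, hC⟩ := IsBigO.bound hder
  rw [eventually_principal] at hC
  have hE := eq_zero_of_abs_deriv_le_mul_abs_self_of_eq_zero_right (K := C) (a := 0) (b := T)
    (f := (cellIntegral e)) (f' := (cellIntegral (dirDeriv (1, 0) e)))
    (fun t _ => (hasDerivAt_cellIntegral e t).continuousAt.continuousWithinAt)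
    (fun t _ => (hasDerivAt_cellIntegral e t).hasDerivWithinAt)
    (by simp [cellIntegral, h0])
    (fun t ht => hC t ⟨ht.1, ht.2.le⟩)
  intro t ht x
  have hae := (setIntegral_eq_zero_iff_of_nonneg_ae
    (Eventually.of_forall fun x => he t ht x) (integrableOn_slice e t)).1 (hE t ht)
  have heq : Set.EqOn (fun x => e.1 (t, x)) 0 (Set.Icc (0 : Vec d) 1) := by
    refine Measure.eqOn_of_ae_eq hae (continuous_slice e t).continuousOn continuousOn_const ?_
    have hint : (interior (Set.Icc (0 : Vec d) 1)).Nonempty := by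
      refine ⟨fun _ => 1 / 2, ?_⟩
      rw [← Set.pi_univ_Icc, interior_pi_set Set.finite_univ]
      intro i _
      simp only [Pi.zero_apply, Pi.one_apply, interior_Icc]
      constructor <;> norm_num
    rw [(convex_Icc (𝕜 := ℝ) (0 : Vec d) 1).closure_interior_eq_closure_of_nonempty_interior
      hint]
    exact subset_closure
  have h := e.2.2 t (fun i => Int.fract (x i)) (fun i => ⌊x i⌋)
  simp only [Int.fract_add_floor] at h
  rw [h]
  exact heq ⟨fun i => Int.fract_nonneg _, fun i => (Int.fract_lt_one _).le⟩

theorem comp_sub_mem_bigOIdeal {T : ℝ} {w : ℝ × Vec d → ℝ} {f : ℝ → ℝ}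
    (hf : ContDiff ℝ (⊤ : ℕ∞) f) {F G : periodicSmooth d} (h : F - G ∈ bigOIdeal T w) :
    comp f hf F - comp f hf G ∈ bigOIdeal T w := by
  obtain ⟨C, hC⟩ := (isBigO_one F T).bound
  obtain ⟨C', hC'⟩ := (isBigO_one G T).bound
  rw [eventually_principal] at hC hC'
  obtain ⟨L, hL⟩ := (isCompact_Icc (a := -max C C') (b := max C C')).exists_bound_of_continuousOn
    hf.deriv_infty.continuous.continuousOn
  refine IsBigO.trans (g := (F - G).1) (IsBigO.of_bound L ?_) h
  rw [eventually_principal]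
  intro p hp
  have hF := hC p hp
  have hG := hC' p hp
  simp only [norm_one, mul_one, Real.norm_eq_abs] at hF hG
  exact (convex_Icc (-max C C') (max C C')).norm_image_sub_le_of_norm_deriv_le
    (fun x _ => hf.differentiable (by simp) x) hL
    (abs_le.1 (hG.trans (le_max_right _ _))) (abs_le.1 (hF.trans (le_max_left _ _)))

theorem dirDeriv_comp_sub_mem_bigOIdeal {T : ℝ} {w : ℝ × Vec d → ℝ} {f : ℝ → ℝ}
    (hf : ContDiff ℝ (⊤ : ℕ∞) f) {F G : periodicSmooth d} (v : ℝ × Vec d)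
    (h : F - G ∈ bigOIdeal T w) (hd : dirDeriv v (F - G) ∈ bigOIdeal T w) :
    dirDeriv v (comp f hf F - comp f hf G) ∈ bigOIdeal T w := by
  have e : dirDeriv v (comp f hf F - comp f hf G) =
      comp (deriv f) hf.deriv_infty F * dirDeriv v (F - G) +
        (comp (deriv f) hf.deriv_infty F - comp (deriv f) hf.deriv_infty G) * dirDeriv v G := by
    rw [map_sub, map_sub, dirDeriv_comp, dirDeriv_comp]; ring
  rw [e]
  exact add_mem (Ideal.mul_mem_left _ _ hd)
    (Ideal.mul_mem_right _ _ (comp_sub_mem_bigOIdeal hf.deriv_infty h))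

theorem mem_bigOIdeal_sqrt {T c : ℝ} (hc : 0 < c) {w : ℝ × Vec d → ℝ} {F : periodicSmooth d}
    (h : ∀ t ∈ Set.Icc 0 T, ∀ x, c * F.1 (t, x) ^ 2 ≤ w (t, x)) :
    F ∈ bigOIdeal T (fun p => √(w p)) := by
  refine IsBigO.of_bound (√c)⁻¹ ?_
  rw [eventually_principal]
  rintro ⟨t, x⟩ ⟨ht, -⟩
  have h1 := Real.sqrt_le_sqrt (h t ht x)
  rw [Real.sqrt_mul hc.le, Real.sqrt_sq_eq_abs] at h1
  rw [Real.norm_of_nonneg (Real.sqrt_nonneg _), inv_mul_eq_div,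
    le_div_iff₀ (Real.sqrt_pos.2 hc), mul_comm]
  exact h1

theorem mul_mem_bigOIdeal_of_sqrt {T : ℝ} {w : ℝ × Vec d → ℝ}
    (hw : ∀ t ∈ Set.Icc 0 T, ∀ x, 0 ≤ w (t, x)) {F G : periodicSmooth d}
    (hF : F ∈ bigOIdeal T (fun p => √(w p))) (hG : G ∈ bigOIdeal T (fun p => √(w p))) :
    F * G ∈ bigOIdeal T w := by
  refine (IsBigO.mul hF hG).congr' EventuallyEq.rfl ?_
  rw [EventuallyEq, eventually_principal]
  rintro ⟨t, x⟩ ⟨ht, -⟩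
  exact Real.mul_self_sqrt (hw t ht x)

theorem mem_bigOIdeal_of_eq_zero {T : ℝ} {w : ℝ × Vec d → ℝ} {F : periodicSmooth d}
    (h : ∀ t ∈ Set.Icc 0 T, ∀ x, F.1 (t, x) = 0) : F ∈ bigOIdeal T w := by
  refine IsBigO.of_bound 0 ?_
  rw [eventually_principal]
  rintro ⟨t, x⟩ ⟨ht, -⟩
  simp [h t ht x]

/-- Evaluation at a point as a ring homomorphism. -/
def eval (p : ℝ × Vec d) : periodicSmooth d →+* ℝ :=
  (Pi.evalRingHom _ p).comp (periodicSmooth d).val.toRingHom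

theorem eval_apply (p : ℝ × Vec d) (F : periodicSmooth d) : eval p F = F.1 p := rfl

/-- Half of the derivative of a smooth function of one variable, composed with `F`. -/
def halfDerivComp (K : ℝ → ℝ) (hK : ContDiff ℝ (⊤ : ℕ∞) K) (F : periodicSmooth d) :
    periodicSmooth d :=
  comp (fun z => 1 / 2 * deriv K z) (contDiff_const.mul hK.deriv_infty) F

theorem dirDeriv_comp_eq_halfDerivComp (K : ℝ → ℝ) (hK : ContDiff ℝ (⊤ : ℕ∞) K)
    (F : periodicSmooth d) (v : ℝ × Vec d) :
    dirDeriv v (comp K hK F) = 2 * halfDerivComp K hK F * dirDeriv v F := by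
  rw [dirDeriv_comp, two_mul]
  congr 1
  refine Subtype.ext <| funext fun p => ?_
  change deriv K (F.1 p) = 1 / 2 * deriv K (F.1 p) + 1 / 2 * deriv K (F.1 p)
  ring

/-- Partial derivative in time. -/
abbrev dt : Derivation ℝ (periodicSmooth d) (periodicSmooth d) := dirDeriv (1, 0)

/-- Partial derivative in the `i`-th space direction. -/
abbrev dx (i : Fin d) : Derivation ℝ (periodicSmooth d) (periodicSmooth d) :=
  dirDeriv (0, Pi.single i 1)

/-- The capillarity potential `K(ρ)Δρ + ½K'(ρ)|∇ρ|²`. -/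
def capillarity (K : ℝ → ℝ) (hK : ContDiff ℝ (⊤ : ℕ∞) K) (ρ : periodicSmooth d) :
    periodicSmooth d :=
  comp K hK ρ * ∑ j, dx j (dx j ρ) + halfDerivComp K hK ρ * ∑ j, dx j ρ ^ 2

/-- Residual of the continuity equation. -/
def massResidual (ρ : periodicSmooth d) (u : Fin d → periodicSmooth d) : periodicSmooth d :=
  dt ρ + ∑ i, dx i (ρ * u i)

/-- Residual of the momentum equation in non-conservative form, with enthalpy derivative `g`. -/
def momentumResidual (K g : ℝ → ℝ) (hK : ContDiff ℝ (⊤ : ℕ∞) K) (hg : ContDiff ℝ (⊤ : ℕ∞) g)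
    (ρ : periodicSmooth d) (u : Fin d → periodicSmooth d) (i : Fin d) : periodicSmooth d :=
  dt (u i) + ∑ j, u j * dx j (u i) + comp g hg ρ * dx i ρ - dx i (capillarity K hK ρ)

/-- Uniqueness for the Euler–Korteweg system in non-conservative form with general smooth
capillarity and enthalpy. -/
theorem eq_of_residual_eq_zero {T a c : ℝ} (ha : 0 < a) (hc : 0 < c) (K g : ℝ → ℝ)
    (hK : ContDiff ℝ (⊤ : ℕ∞) K) (hg : ContDiff ℝ (⊤ : ℕ∞) g)
    (ρ r : periodicSmooth d) (u U : Fin d → periodicSmooth d)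
    (hρ : ∀ t ∈ Set.Icc 0 T, ∀ x, a ≤ ρ.1 (t, x))
    (hKρ : ∀ t ∈ Set.Icc 0 T, ∀ x, c ≤ K (ρ.1 (t, x)))
    (hmass : ∀ t ∈ Set.Icc 0 T, ∀ x, (massResidual ρ u).1 (t, x) = 0)
    (hmass' : ∀ t ∈ Set.Icc 0 T, ∀ x, (massResidual r U).1 (t, x) = 0)
    (hmom : ∀ i, ∀ t ∈ Set.Icc 0 T, ∀ x, (momentumResidual K g hK hg ρ u i).1 (t, x) = 0)
    (hmom' : ∀ i, ∀ t ∈ Set.Icc 0 T, ∀ x, (momentumResidual K g hK hg r U i).1 (t, x) = 0)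
    (hρ0 : ∀ x, ρ.1 (0, x) = r.1 (0, x)) (hu0 : ∀ i x, (u i).1 (0, x) = (U i).1 (0, x)) :
    ∀ t ∈ Set.Icc 0 T, ∀ x, ρ.1 (t, x) = r.1 (t, x) ∧ ∀ i, (u i).1 (t, x) = (U i).1 (t, x) := by
  obtain ⟨n, hn⟩ : ∃ n, n = ρ - r := ⟨_, rfl⟩
  obtain ⟨v, hv⟩ : ∃ v : Fin d → periodicSmooth d, ∀ i, v i = u i - U i := ⟨_, fun _ => rfl⟩
  obtain ⟨e, he⟩ : ∃ e, e = ρ * ∑ i, v i ^ 2 + comp K hK ρ * ∑ i, dx i n ^ 2 + n ^ 2 :=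
    ⟨_, rfl⟩
  have he_apply : ∀ p, e.1 p = ρ.1 p * ∑ i, (v i).1 p ^ 2 +
      K (ρ.1 p) * ∑ i, (dx i n).1 p ^ 2 + n.1 p ^ 2 := by
    intro p
    have : eval p e = eval p ρ * ∑ i, eval p (v i) ^ 2 +
        eval p (comp K hK ρ) * ∑ i, eval p (dx i n) ^ 2 + eval p n ^ 2 := by
      rw [he]; simp only [map_add, map_mul, map_sum, map_pow]
    exact this
  have hlow : ∀ t ∈ Set.Icc 0 T, ∀ x, a * ∑ i, (v i).1 (t, x) ^ 2 +
      c * ∑ i, (dx i n).1 (t, x) ^ 2 + n.1 (t, x) ^ 2 ≤ e.1 (t, x) := by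
    intro t ht x
    rw [he_apply]
    have h1 := hρ t ht x
    have h2 := hKρ t ht x
    gcongr
  have hs1 : ∀ p, 0 ≤ ∑ i, (v i).1 p ^ 2 := fun p => Finset.sum_nonneg fun i _ => sq_nonneg _
  have hs2 : ∀ p, 0 ≤ ∑ i, (dx i n).1 p ^ 2 := fun p => Finset.sum_nonneg fun i _ => sq_nonneg _
  have hs1' : ∀ i p, (v i).1 p ^ 2 ≤ ∑ i, (v i).1 p ^ 2 := fun i p =>
    Finset.single_le_sum (f := fun i => (v i).1 p ^ 2) (fun i _ => sq_nonneg _) (Finset.mem_univ i)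
  have hs2' : ∀ i p, (dx i n).1 p ^ 2 ≤ ∑ i, (dx i n).1 p ^ 2 := fun i p =>
    Finset.single_le_sum (f := fun i => (dx i n).1 p ^ 2) (fun i _ => sq_nonneg _)
      (Finset.mem_univ i)
  have hnle : ∀ t ∈ Set.Icc 0 T, ∀ x, 1 * n.1 (t, x) ^ 2 ≤ e.1 (t, x) := fun t ht x => by
    have := hlow t ht x
    have := mul_nonneg ha.le (hs1 (t, x))
    have := mul_nonneg hc.le (hs2 (t, x))
    linarith
  have hvle : ∀ i, ∀ t ∈ Set.Icc 0 T, ∀ x, a * (v i).1 (t, x) ^ 2 ≤ e.1 (t, x) :=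
    fun i t ht x => by
      have := hlow t ht x
      have := mul_le_mul_of_nonneg_left (hs1' i (t, x)) ha.le
      have := mul_nonneg hc.le (hs2 (t, x))
      have := sq_nonneg (n.1 (t, x))
      linarith
  have hdle : ∀ i, ∀ t ∈ Set.Icc 0 T, ∀ x, c * (dx i n).1 (t, x) ^ 2 ≤ e.1 (t, x) :=
    fun i t ht x => by
      have := hlow t ht x
      have := mul_le_mul_of_nonneg_left (hs2' i (t, x)) hc.le
      have := mul_nonneg ha.le (hs1 (t, x))
      have := sq_nonneg (n.1 (t, x))
      linarith
  have he0 : ∀ t ∈ Set.Icc 0 T, ∀ x, 0 ≤ e.1 (t, x) := fun t ht x =>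
    le_trans (by positivity) (hnle t ht x)
  have hnI := mem_bigOIdeal_sqrt one_pos hnle
  have hdI := fun i => mem_bigOIdeal_sqrt hc (hdle i)
  have hvI := fun i => mem_bigOIdeal_sqrt ha (hvle i)
  have hnI' : ρ - r ∈ bigOIdeal T (fun p => √(e.1 p)) := by rw [← hn]; exact hnI
  have hdI' : ∀ i, dx i (ρ - r) ∈ bigOIdeal T (fun p => √(e.1 p)) := by rw [← hn]; exact hdI
  have hmassQ : massResidual ρ u - massResidual r U ∈ bigOIdeal T e.1 :=
    sub_mem (mem_bigOIdeal_of_eq_zero hmass) (mem_bigOIdeal_of_eq_zero hmass')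
  have hmomQ : ∀ i, momentumResidual K g hK hg ρ u i - momentumResidual K g hK hg r U i ∈
      bigOIdeal T e.1 := fun i =>
    sub_mem (mem_bigOIdeal_of_eq_zero (hmom i)) (mem_bigOIdeal_of_eq_zero (hmom' i))
  have hDN : ∀ i a, dx i a ∈ integralControlled T e := fun i a =>
    (isBigO_zero _ _).congr_left fun t => (cellIntegral_dirDeriv_space i a t).symm
  have key : dt (ρ * ∑ i, v i ^ 2 + comp K hK ρ * ∑ i, dx i n ^ 2 + n ^ 2) ∈
      integralControlled T e := by
    unfold massResidual at hmassQ
    unfold momentumResidual capillarity at hmomQ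
    have hκt := dirDeriv_comp_eq_halfDerivComp K hK ρ (1, 0)
    have hκx := fun i : Fin d => dirDeriv_comp_eq_halfDerivComp K hK ρ (0, Pi.single i 1)
    have hκ := comp_sub_mem_bigOIdeal hK hnI'
    have hdκ := fun i => dirDeriv_comp_sub_mem_bigOIdeal hK _ hnI' (hdI' i)
    have hm : halfDerivComp K hK ρ - halfDerivComp K hK r ∈ bigOIdeal T (fun p => √(e.1 p)) :=
      comp_sub_mem_bigOIdeal _ hnI'
    have hdm : ∀ i, dx i (halfDerivComp K hK ρ - halfDerivComp K hK r) ∈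
        bigOIdeal T (fun p => √(e.1 p)) :=
      fun i => dirDeriv_comp_sub_mem_bigOIdeal _ _ hnI' (hdI' i)
    have hg' := comp_sub_mem_bigOIdeal hg hnI'
    have hxt : ∀ (i : Fin d) (a : periodicSmooth d), dt (dx i a) = dx i (dt a) := fun i a =>
      dirDeriv_comm (1, 0) (0, Pi.single i 1) a
    have hxx : ∀ (i j : Fin d) (a : periodicSmooth d), dx i (dx j a) = dx j (dx i a) :=
      fun i j a => dirDeriv_comm (0, Pi.single i 1) (0, Pi.single j 1) a
    exact relative_energy_derivation_mem dt dx
      hxt hxx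
      (bigOIdeal T (fun p => √(e.1 p))) (bigOIdeal T e.1) (integralControlled T e)
      (fun a ha b hb => mul_mem_bigOIdeal_of_sqrt he0 ha hb)
      (fun a ha => bigOIdeal_le_integralControlled he0 ha) hDN
      ρ r n (comp K hK ρ) (comp K hK r) (halfDerivComp K hK ρ) (halfDerivComp K hK r)
      (comp g hg ρ) (comp g hg r) u U v hn hv hnI hdI hvI
      hκt hκx hκ hdκ hm hdm hg' hmassQ hmomQ
  rw [← he] at key
  have hn0 : ∀ x, n.1 (0, x) = 0 := fun x => by
    rw [hn]; exact sub_eq_zero.2 (hρ0 x)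
  have hinit : ∀ x, e.1 (0, x) = 0 := by
    intro x
    have h1 : ∀ i, (v i).1 (0, x) = 0 := fun i => by
      rw [hv]; exact sub_eq_zero.2 (hu0 i x)
    have h2 : ∀ i, (dx i n).1 (0, x) = 0 := fun i => by
      have h3 : HasFDerivAt (fun y => n.1 (0, y))
          ((fderiv ℝ n.1 (0, x)).comp (ContinuousLinearMap.inr ℝ ℝ (Vec d))) x :=
        (differentiable n (0, x)).hasFDerivAt.comp x (hasFDerivAt_prodMk_right 0 x)
      have h4 : (fun y => n.1 (0, y)) = fun _ => 0 := funext hn0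
      rw [h4] at h3
      have h5 := congrArg (fun L => L (Pi.single i 1)) (h3.unique (hasFDerivAt_const _ _))
      simpa [dirDeriv_apply] using h5
    rw [he_apply]
    simp [h1, h2, hn0]
  have hzero := eq_zero_of_dirDeriv_mem he0 hinit key
  intro t ht x
  have hz := hzero t ht x
  constructor
  · have h1 := hnle t ht x
    rw [hz, one_mul] at h1
    have h2 : n.1 (t, x) = 0 := pow_eq_zero_iff two_ne_zero |>.1 (le_antisymm h1 (sq_nonneg _))
    rw [hn] at h2
    exact sub_eq_zero.1 h2
  · intro i
    have h1 := hvle i t ht x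
    rw [hz] at h1
    have h2 : (v i).1 (t, x) = 0 := pow_eq_zero_iff two_ne_zero |>.1
      (le_antisymm (nonpos_of_mul_nonpos_right h1 ha) (sq_nonneg _))
    rw [hv] at h2
    exact sub_eq_zero.1 h2

theorem pd_slice (i : Fin d) (F : periodicSmooth d) (t : ℝ) (x : Vec d) :
    pd i (fun y => F.1 (t, y)) x = (dx i F).1 (t, x) := by
  have h : HasFDerivAt (fun y => F.1 (t, y))
      ((fderiv ℝ F.1 (t, x)).comp (ContinuousLinearMap.inr ℝ ℝ (Vec d))) x :=
    (differentiable F (t, x)).hasFDerivAt.comp x (hasFDerivAt_prodMk_right t x)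
  rw [pd, h.fderiv]
  simp [dirDeriv_apply]

end periodicSmooth

open periodicSmooth

/-- A smooth positive function agreeing with the identity away from `(-∞, a/2]`. -/
theorem exists_contDiff_pos_eq_self {a : ℝ} (ha : 0 < a) :
    ∃ η : ℝ → ℝ, ContDiff ℝ (⊤ : ℕ∞) η ∧ (∀ z, 0 < η z) ∧ ∀ z, a / 2 < z → η z = z := by
  have hχ : ContDiff ℝ (⊤ : ℕ∞) fun z : ℝ => Real.smoothTransition (4 / a * z - 1) :=
    Real.smoothTransition.contDiff.comp (by fun_prop)
  refine ⟨fun z => Real.smoothTransition (4 / a * z - 1) * z +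
    (1 - Real.smoothTransition (4 / a * z - 1)), ?_, fun z => ?_, fun z hz => ?_⟩
  · exact (hχ.mul contDiff_id).add (contDiff_const.sub hχ)
  · rcases le_or_gt z 0 with hz | hz
    · have h : 4 / a * z - 1 ≤ 0 := by
        have : 4 / a * z ≤ 0 := mul_nonpos_of_nonneg_of_nonpos (by positivity) hz
        linarith
      simp [Real.smoothTransition.zero_of_nonpos h]
    · have h0 := Real.smoothTransition.nonneg (4 / a * z - 1)
      rcases (Real.smoothTransition.le_one (4 / a * z - 1)).lt_or_eq with h1 | h1
      · have := mul_nonneg h0 hz.le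
        simp only; linarith
      · simp only [h1]; linarith
  · have h : 1 ≤ 4 / a * z - 1 := by
      have h1 : 4 / a * (a / 2) ≤ 4 / a * z := by gcongr
      have h2 : 4 / a * (a / 2) = 2 := by field_simp; norm_num
      linarith
    simp [Real.smoothTransition.one_of_one_le h]

theorem SolvesEuK.massResidual_eq_zero {d : ℕ} {T ε γ s : ℝ} {ρ : periodicSmooth d}
    {u : Fin d → periodicSmooth d}
    (h : SolvesEuK d T ε γ s (fun t x => ρ.1 (t, x)) (fun t x i => (u i).1 (t, x))) :
    ∀ t ∈ Set.Icc 0 T, ∀ x, (massResidual ρ u).1 (t, x) = 0 := by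
  intro t ht x
  have h1 := h.1 t ht x
  rw [(hasDerivAt_time ρ t x).deriv] at h1
  have h2 : ∀ i, pd i (fun y => ρ.1 (t, y) * (u i).1 (t, y)) x = (dx i (ρ * u i)).1 (t, x) :=
    fun i => pd_slice i (ρ * u i) t x
  simp only [h2] at h1
  rw [← h1, ← eval_apply, massResidual, map_add, map_sum]
  rfl

theorem SolvesEuK.momentumResidual_eq_zero {d : ℕ} {T ε γ s a : ℝ} (hε : 0 < ε) (ha : 0 < a)
    {K g : ℝ → ℝ} (hK : ContDiff ℝ (⊤ : ℕ∞) K) (hg : ContDiff ℝ (⊤ : ℕ∞) g)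
    (hKa : ∀ z, a / 2 < z → K z = ε ^ 2 * ((s + 3) ^ 2 / 4 * z ^ s))
    (hga : ∀ z, a / 2 < z → g z = γ * z ^ (γ - 2))
    {ρ : periodicSmooth d} {u : Fin d → periodicSmooth d}
    (hρ : ∀ t ∈ Set.Icc 0 T, ∀ x, a ≤ ρ.1 (t, x))
    (h : SolvesEuK d T ε γ s (fun t x => ρ.1 (t, x)) (fun t x i => (u i).1 (t, x))) (i : Fin d) :
    ∀ t ∈ Set.Icc 0 T, ∀ x, (momentumResidual K g hK hg ρ u i).1 (t, x) = 0 := by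
  intro t ht x
  have hmass := h.massResidual_eq_zero t ht x
  have h1 := h.2 t ht x i
  have hpos : 0 < ρ.1 (t, x) := ha.trans_le (hρ t ht x)
  have hdK : ∀ z, a ≤ z → deriv K z = ε ^ 2 * ((s + 3) ^ 2 / 4 * s * z ^ (s - 1)) := by
    intro z hz
    have hz0 : z ≠ 0 := by linarith
    have hev : K =ᶠ[𝓝 z] fun z => ε ^ 2 * ((s + 3) ^ 2 / 4 * z ^ s) := by
      filter_upwards [Ioi_mem_nhds (show a / 2 < z by linarith)] with y hy using hKa y hy
    rw [hev.deriv_eq,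
      (((Real.hasDerivAt_rpow_const (Or.inl hz0)).const_mul _).const_mul _).deriv]
    ring
  have e1 : deriv (fun τ => ρ.1 (τ, x) * (u i).1 (τ, x)) t = (dt (ρ * u i)).1 (t, x) :=
    (hasDerivAt_time (ρ * u i) t x).deriv
  have e2 : ∀ j, pd j (fun y => ρ.1 (t, y) * (u i).1 (t, y) * (u j).1 (t, y)) x =
      (dx j (ρ * u i * u j)).1 (t, x) := fun j => pd_slice j (ρ * u i * u j) t x
  have e3 : pd i (fun y => ρ.1 (t, y) ^ γ) x = γ * ρ.1 (t, x) ^ (γ - 1) * (dx i ρ).1 (t, x) := by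
    have hd : HasFDerivAt (fun y => ρ.1 (t, y))
        ((fderiv ℝ ρ.1 (t, x)).comp (ContinuousLinearMap.inr ℝ ℝ (Vec d))) x :=
      (differentiable ρ (t, x)).hasFDerivAt.comp x (hasFDerivAt_prodMk_right t x)
    rw [pd, (hd.rpow_const (Or.inl hpos.ne')).fderiv]
    simp [dirDeriv_apply]
  have e4 : (fun y => ((s + 3) ^ 2 / 4) * ρ.1 (t, y) ^ s *
        (∑ j, pd j (fun z => pd j (fun w => ρ.1 (t, w)) z) y)
      + (1 / 2) * (((s + 3) ^ 2 / 4) * s * ρ.1 (t, y) ^ (s - 1))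
        * ∑ j, (pd j (fun w => ρ.1 (t, w)) y) ^ 2) =
      fun y => ((ε ^ 2)⁻¹ • capillarity K hK ρ).1 (t, y) := by
    funext y
    have ha' := hρ t ht y
    have c1 : (capillarity K hK ρ).1 (t, y) = K (ρ.1 (t, y)) * ∑ j, (dx j (dx j ρ)).1 (t, y) +
        1 / 2 * deriv K (ρ.1 (t, y)) * ∑ j, (dx j ρ).1 (t, y) ^ 2 := by
      rw [← eval_apply, capillarity, map_add, map_mul, map_mul, map_sum, map_sum]
      simp only [map_pow]
      rfl
    change _ = (ε ^ 2)⁻¹ * (capillarity K hK ρ).1 (t, y)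
    rw [c1, hdK _ ha', hKa _ (by linarith)]
    simp only [pd_slice]
    field_simp
  simp only at h1
  rw [e1, e3, e4, pd_slice, Derivation.map_smul] at h1
  simp only [e2] at h1
  change _ = ε ^ 2 * ρ.1 (t, x) * ((ε ^ 2)⁻¹ * (dx i (capillarity K hK ρ)).1 (t, x)) at h1
  have hgx : ρ.1 (t, x) * (comp g hg ρ).1 (t, x) = γ * ρ.1 (t, x) ^ (γ - 1) := by
    change ρ.1 (t, x) * g (ρ.1 (t, x)) = _
    rw [hga _ (by linarith [hρ t ht x]), show γ - 1 = 1 + (γ - 2) by ring,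
      Real.rpow_add hpos, Real.rpow_one]
    ring
  rw [← hgx] at h1
  have hε2 : ε ^ 2 * (ε ^ 2)⁻¹ = 1 := mul_inv_cancel₀ (by positivity)
  simp only [← eval_apply] at h1 hmass hpos ⊢
  have hsplit : ρ * momentumResidual K g hK hg ρ u i = dt (ρ * u i) + ∑ j, dx j (ρ * u i * u j)
      + ρ * comp g hg ρ * dx i ρ - ρ * dx i (capillarity K hK ρ) - u i * massResidual ρ u := by
    have h5 : ∑ j, dx j (ρ * u i * u j) =
        ρ * ∑ j, u j * dx j (u i) + u i * ∑ j, dx j (ρ * u j) := by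
      rw [Finset.mul_sum, Finset.mul_sum, ← Finset.sum_add_distrib]
      refine Finset.sum_congr rfl fun j _ => ?_
      simp only [Derivation.leibniz, smul_eq_mul]; ring
    rw [h5, momentumResidual, massResidual, Derivation.leibniz]
    simp only [smul_eq_mul]; ring
  have h6 := congrArg (eval (t, x)) hsplit
  simp only [map_add, map_sub, map_mul, map_sum, hmass] at h6 h1
  refine (mul_eq_zero.1 (h6.trans ?_)).resolve_left hpos.ne'
  linear_combination h1 + (eval (t, x) ρ * eval (t, x) (dx i (capillarity K hK ρ))) * hε2

/-- Uniqueness of strong solutions of the Euler–Korteweg system via the relative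
entropy: two smooth, positive, bounded solutions with the same initial data coincide
on `[0,T] × 𝕋^d`. -/
theorem euk_strong_uniqueness
    (d : ℕ) (hd1 : 1 ≤ d) (hd3 : d ≤ 3)
    (T ε γ s a b : ℝ) (hT : 0 < T) (hε : 0 < ε) (hs : -1 ≤ s) (hγs : s + 2 ≤ γ)
    (hγ : 1 < γ) (ha : 0 < a) (hab : a ≤ b)
    (ρ r : ℝ → Vec d → ℝ) (u U : ℝ → Vec d → Vec d)
    (hρs : ContDiff ℝ (⊤ : ℕ∞) (fun p : ℝ × Vec d => ρ p.1 p.2))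
    (hus : ContDiff ℝ (⊤ : ℕ∞) (fun p : ℝ × Vec d => u p.1 p.2))
    (hrs : ContDiff ℝ (⊤ : ℕ∞) (fun p : ℝ × Vec d => r p.1 p.2))
    (hUs : ContDiff ℝ (⊤ : ℕ∞) (fun p : ℝ × Vec d => U p.1 p.2))
    (hρper : SpacePeriodic ρ) (huper : SpacePeriodic u)
    (hrper : SpacePeriodic r) (hUper : SpacePeriodic U)
    (hρab : ∀ t ∈ Set.Icc 0 T, ∀ x, a ≤ ρ t x ∧ ρ t x ≤ b)
    (hrab : ∀ t ∈ Set.Icc 0 T, ∀ x, a ≤ r t x ∧ r t x ≤ b)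
    (hsol : SolvesEuK d T ε γ s ρ u)
    (hSOL : SolvesEuK d T ε γ s r U)
    (hinitρ : ∀ x, ρ 0 x = r 0 x)
    (hinitu : ∀ x, u 0 x = U 0 x) :
    ∀ t ∈ Set.Icc 0 T, ∀ x : Vec d, ρ t x = r t x ∧ ∀ i, u t x i = U t x i := by
  obtain ⟨η, hη, hηpos, hηa⟩ := exists_contDiff_pos_eq_self ha
  let ρ' : periodicSmooth d := ⟨fun p => ρ p.1 p.2, hρs, hρper⟩
  let r' : periodicSmooth d := ⟨fun p => r p.1 p.2, hrs, hrper⟩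
  let u' : Fin d → periodicSmooth d := fun i => ⟨fun p => u p.1 p.2 i, contDiff_pi.1 hus i,
    fun t x k => congrFun (huper t x k) i⟩
  let U' : Fin d → periodicSmooth d := fun i => ⟨fun p => U p.1 p.2 i, contDiff_pi.1 hUs i,
    fun t x k => congrFun (hUper t x k) i⟩
  have hK : ContDiff ℝ (⊤ : ℕ∞) fun z => ε ^ 2 * ((s + 3) ^ 2 / 4 * η z ^ s) :=
    contDiff_const.mul (contDiff_const.mul (hη.rpow_const_of_ne fun z => (hηpos z).ne'))
  have hg : ContDiff ℝ (⊤ : ℕ∞) fun z => γ * η z ^ (γ - 2) :=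
    contDiff_const.mul (hη.rpow_const_of_ne fun z => (hηpos z).ne')
  have hKa : ∀ z, a / 2 < z → ε ^ 2 * ((s + 3) ^ 2 / 4 * η z ^ s) =
      ε ^ 2 * ((s + 3) ^ 2 / 4 * z ^ s) := fun z hz => by rw [hηa z hz]
  have hga : ∀ z, a / 2 < z → γ * η z ^ (γ - 2) = γ * z ^ (γ - 2) := fun z hz => by
    rw [hηa z hz]
  obtain ⟨z₀, -, hz₀⟩ := (isCompact_Icc (a := a) (b := b)).exists_isMinOn
    (Set.nonempty_Icc.2 hab) hK.continuous.continuousOn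
  have hs3 : s + 3 ≠ 0 := by linarith
  have hc : 0 < ε ^ 2 * ((s + 3) ^ 2 / 4 * η z₀ ^ s) := by
    have := Real.rpow_pos_of_pos (hηpos z₀) s
    positivity
  have hρa : ∀ t ∈ Set.Icc 0 T, ∀ x, a ≤ ρ'.1 (t, x) := fun t ht x => (hρab t ht x).1
  have hra : ∀ t ∈ Set.Icc 0 T, ∀ x, a ≤ r'.1 (t, x) := fun t ht x => (hrab t ht x).1
  have hsol' : SolvesEuK d T ε γ s (fun t x => ρ'.1 (t, x)) (fun t x i => (u' i).1 (t, x)) := hsol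
  have hSOL' : SolvesEuK d T ε γ s (fun t x => r'.1 (t, x)) (fun t x i => (U' i).1 (t, x)) := hSOL
  exact eq_of_residual_eq_zero ha hc _ _ hK hg ρ' r' u' U' hρa
    (fun t ht x => hz₀ (hρab t ht x))
    hsol'.massResidual_eq_zero hSOL'.massResidual_eq_zero
    (fun i => hsol'.momentumResidual_eq_zero hε ha hK hg hKa hga hρa i)
    (fun i => hSOL'.momentumResidual_eq_zero hε ha hK hg hKa hga hra i)
    hinitρ (fun i x => congrFun (hinitu x) i)
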